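/- Let M = {1^{k_1}, 2^{k_2}, ..., n^{k_n}} be a multiset with each k_i ≥ 1 and K = k_1 + k_2 + ... + k_n. Then the polynomial IT_M(x,y,z) = Σ_{T ∈ ℐ𝒯_M} x^{casc(T)} y^{cdes(T)} z^{eleaf(T)} is partial γ-positive; more precisely, IT_M(x,y,z) = Σ_{i=0}^{K−n} z^i Σ_{j=1}^{⌊(K+1−i)/2⌋} γ_{i,j} (xy)^j (x+y)^{K+1−i−2j}, where γ_{i,j} is the number of trees T ∈ ℐ𝒯_M with cdes(T) = j, eleaf(T) = i and dcdes(T) = 0. -/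

import Mathlib

/-! Common definitions: words (permutations of multisets), their statistics,
ordered labeled trees and their cyclic statistics. -/

attribute [local instance] Classical.propDecidable

/-- `asc`: number of indices `0 ≤ i ≤ m` with `π_i < π_{i+1}`, convention `π_0 = π_{m+1} = 0`. -/
def ascW (w : List ℕ) : ℕ :=
  (((0 :: (w ++ [0])).zip (w ++ [0])).countP fun p => decide (p.1 < p.2))

def desW (w : List ℕ) : ℕ :=
  (((0 :: (w ++ [0])).zip (w ++ [0])).countP fun p => decide (p.2 < p.1))

def platW (w : List ℕ) : ℕ :=
  (((0 :: (w ++ [0])).zip (w ++ [0])).countP fun p => decide (p.1 = p.2))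

/-- quasi-Stirling: no indices `i < j < k < l` with `π_i = π_k` and `π_j = π_l`. -/
def IsQuasiStirling (w : List ℕ) : Prop :=
  ¬ ∃ l, l < w.length ∧ ∃ k, k < l ∧ ∃ j, j < k ∧ ∃ i, i < j ∧
      w.getD i 0 = w.getD k 0 ∧ w.getD j 0 = w.getD l 0

/-- Stirling: no indices `i < j < k` with `π_i = π_k` and `π_j < π_i`. -/
def IsStirling (w : List ℕ) : Prop :=
  ¬ ∃ k, k < w.length ∧ ∃ j, j < k ∧ ∃ i, i < j ∧
      w.getD i 0 = w.getD k 0 ∧ w.getD j 0 < w.getD i 0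

/-- The multiset `{1^{k 1}, 2^{k 2}, …, n^{k n}}`. -/
def msetM (n : ℕ) (k : ℕ → ℕ) : Multiset ℕ :=
  ∑ i ∈ Finset.Icc 1 n, Multiset.replicate (k i) i

/-- The finite set of all words whose multiset of letters is `M`. -/
noncomputable def permsOf (M : Multiset ℕ) : Finset (List ℕ) :=
  M.toList.permutations.toFinset

/-- The finite set of quasi-Stirling permutations of `M`. -/
noncomputable def qsPerms (M : Multiset ℕ) : Finset (List ℕ) :=
  (permsOf M).filter IsQuasiStirling

/-- The finite set of Stirling permutations of `M`. -/
noncomputable def sPerms (M : Multiset ℕ) : Finset (List ℕ) :=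
  (permsOf M).filter IsStirling

open MvPolynomial in
/-- `Q̄_M(x,y,z)`, with `x = X 0`, `y = X 1`, `z = X 2`. -/
noncomputable def QbarPoly (M : Multiset ℕ) : MvPolynomial (Fin 3) ℤ :=
  ∑ w ∈ qsPerms M, X 0 ^ ascW w * X 1 ^ desW w * X 2 ^ platW w

open MvPolynomial in
/-- `Q_M(x,y,z)`, with `x = X 0`, `y = X 1`, `z = X 2`. -/
noncomputable def QPoly (M : Multiset ℕ) : MvPolynomial (Fin 3) ℤ :=
  ∑ w ∈ sPerms M, X 0 ^ ascW w * X 1 ^ desW w * X 2 ^ platW w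

/-! Cyclic statistics of a word `w_0 w_1 … w_ℓ` read cyclically. -/

/-- Number of cyclic descents of a word: indices `i` with `w_i > w_{i+1}`, indices mod `ℓ+1`. -/
def cdesW (w : List ℕ) : ℕ := ((w.zip (w.rotate 1)).countP fun p => decide (p.2 < p.1))

/-- Number of cyclic ascents. -/
def cascW (w : List ℕ) : ℕ := ((w.zip (w.rotate 1)).countP fun p => decide (p.1 < p.2))

/-- The list of cyclic triples `(w_{i-1}, w_i, w_{i+1})`, indices mod `ℓ+1`. -/
def cycTriples (w : List ℕ) : List (ℕ × ℕ × ℕ) :=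
  (w.rotate (w.length - 1)).zip (w.zip (w.rotate 1))

/-- Number of double cyclic descents of a word: indices with `w_{i-1} > w_i > w_{i+1}`. -/
def dcdesW (w : List ℕ) : ℕ :=
  ((cycTriples w).countP fun p => decide (p.2.1 < p.1 ∧ p.2.2 < p.2.1))

/-- Number of double cyclic ascents of a word: indices with `w_{i-1} < w_i < w_{i+1}`. -/
def dcascW (w : List ℕ) : ℕ :=
  ((cycTriples w).countP fun p => decide (p.1 < p.2.1 ∧ p.2.1 < p.2.2))

/-- Number of cyclic peaks of a word: indices with `w_{i-1} < w_i > w_{i+1}`. -/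
def cpeakW (w : List ℕ) : ℕ :=
  ((cycTriples w).countP fun p => decide (p.1 < p.2.1 ∧ p.2.2 < p.2.1))

/-- Number of cyclic valleys of a word: indices with `w_{i-1} > w_i < w_{i+1}`. -/
def cvalW (w : List ℕ) : ℕ :=
  ((cycTriples w).countP fun p => decide (p.2.1 < p.1 ∧ p.2.1 < p.2.2))

/-- Ordered labeled trees: rooted plane trees with labels in `ℕ`. -/
inductive LTree : Type where
  | node (label : ℕ) (children : List LTree) : LTree

namespace LTree

/-- The label of the root. -/
def label : LTree → ℕ
  | node a _ => a

theorem sizeOf_lt_of_mem {s : LTree} {ts : List LTree} (h : s ∈ ts) {a : ℕ} :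
    sizeOf s < sizeOf (LTree.node a ts) := by
  have := List.sizeOf_lt_of_mem h
  simp only [node.sizeOf_spec]
  omega

/-- The multiset of all vertex labels. -/
def labels : LTree → Multiset ℕ
  | node a ts => a ::ₘ (ts.attach.map (fun s => labels s.1)).sum
decreasing_by exact sizeOf_lt_of_mem s.2

/-- The word `v_0 v_1 … v_ℓ` associated to a vertex: its label followed by the labels of
its children from left to right. -/
def wordOf : LTree → List ℕ
  | node a ts => a :: ts.map label

/-- `cdes(T) = ∑_{u ∈ V(T)} cdes(u)`. -/
def cdes : LTree → ℕ
  | node a ts => cdesW (a :: ts.map label) + (ts.attach.map (fun s => cdes s.1)).sum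
decreasing_by exact sizeOf_lt_of_mem s.2

/-- `casc(T) = ∑_{u ∈ V(T)} casc(u)`. -/
def casc : LTree → ℕ
  | node a ts => cascW (a :: ts.map label) + (ts.attach.map (fun s => casc s.1)).sum
decreasing_by exact sizeOf_lt_of_mem s.2

/-- Auxiliary: number of leaves at even level, `b = true` meaning the current root is at
even level. -/
def eleafAux : LTree → Bool → ℕ
  | node _ ts, b => (cond b (if ts.isEmpty then 1 else 0) 0)
      + (ts.attach.map (fun s => eleafAux s.1 !b)).sum
decreasing_by exact sizeOf_lt_of_mem s.2

/-- `eleaf(T)`: the number of leaves of `T` at even level. -/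
def eleaf (T : LTree) : ℕ := eleafAux T true

/-- Auxiliary: given a word-statistic `f`, sum `f (wordOf u)` over all vertices `u` at even
level (`b = true` meaning the current root is at even level).  Since every vertex of a tree
is classified (as a double cyclic descent/ascent, cyclic peak/valley) by exactly one index
of the word of an even vertex — an even vertex by index `0` of its own word, an odd vertex
by its position in the word of its (even) parent — the corresponding tree statistics are
obtained by summing the word statistics over the even vertices. -/
def evenSum (f : List ℕ → ℕ) : LTree → Bool → ℕ
  | node a ts, b => (cond b (f (a :: ts.map label)) 0)
      + (ts.attach.map (fun s => evenSum f s.1 !b)).sum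
decreasing_by exact sizeOf_lt_of_mem s.2

/-- `dcdes(T)`: the number of vertices of `T` that are double cyclic descents. -/
def dcdes (T : LTree) : ℕ := evenSum dcdesW T true

/-- `dcasc(T)`: the number of vertices of `T` that are double cyclic ascents. -/
def dcasc (T : LTree) : ℕ := evenSum dcascW T true

/-- `cpeak(T)`: the number of vertices of `T` that are cyclic peaks. -/
def cpeak (T : LTree) : ℕ := evenSum cpeakW T true

/-- `cval(T)`: the number of vertices of `T` that are cyclic valleys. -/
def cval (T : LTree) : ℕ := evenSum cvalW T true

/-- Auxiliary: every odd vertex labeled `i` has exactly `k i - 1` children, all labeled `i`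
(`b = true` meaning the current root is at even level). -/
def oddOK (k : ℕ → ℕ) : LTree → Bool → Prop
  | node a ts, b => (b = false → (ts.length = k a - 1 ∧ ∀ s ∈ ts, s.label = a)) ∧
      ∀ s : {x // x ∈ ts}, oddOK k s.1 (!b)
decreasing_by exact sizeOf_lt_of_mem s.2

/-- Weakly increasing: the labels along the path from the root to any leaf are weakly
increasing from top to bottom, i.e. every child's label is at least its parent's label. -/
def incr : LTree → Prop
  | node a ts => (∀ s ∈ ts, a ≤ s.label) ∧ ∀ s : {x // x ∈ ts}, incr s.1
decreasing_by exact sizeOf_lt_of_mem s.2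

end LTree

/-- Membership in `𝒯_M` for `M = {1^{k 1}, …, n^{k n}}`: the multiset of vertex labels is
`{0} ∪ M`, the root is labeled `0`, and every odd vertex labeled `i` has exactly `k i - 1`
children, all labeled `i`. -/
def memTM (n : ℕ) (k : ℕ → ℕ) (T : LTree) : Prop :=
  T.label = 0 ∧ T.labels = 0 ::ₘ msetM n k ∧ T.oddOK k true

/-- Membership in `ℐ𝒯_M`: weakly increasing trees in `𝒯_M`. -/
def memIT (n : ℕ) (k : ℕ → ℕ) (T : LTree) : Prop :=
  memTM n k T ∧ T.incr

section

open MvPolynomial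

/-! ### Generating function weights of words -/

/-- The coefficient ring `ℤ[u, s, t, z]`: `u = X 0` marks cyclic peaks, `s = X 1` double cyclic
ascents, `t = X 2` double cyclic descents and `z = X 3` even leaves. -/
abbrev WeightRing : Type := MvPolynomial (Fin 4) ℤ

/-- The derivation of the grammar `u → u (s + t)`, `s → u`, `t → u`, `z → u`. -/
noncomputable def grammarD : Derivation ℤ WeightRing WeightRing :=
  mkDerivation ℤ ![X 0 * (X 1 + X 2), X 0, X 0, X 0]

theorem grammarD_X0 : grammarD (X 0) = X 0 * (X 1 + X 2) := by
  simp [grammarD, mkDerivation_X]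

theorem grammarD_X1 : grammarD (X 1) = X 0 := by
  simp [grammarD, mkDerivation_X]

theorem grammarD_X2 : grammarD (X 2) = X 0 := by
  simp [grammarD, mkDerivation_X]

theorem grammarD_X3 : grammarD (X 3) = X 0 := by
  simp [grammarD, mkDerivation_X]

/-- The weight of the middle letter of a triple of consecutive letters. -/
noncomputable def tripleWt (p : ℕ × ℕ × ℕ) : WeightRing :=
  if p.1 < p.2.1 then (if p.2.2 < p.2.1 then X 0 else if p.2.1 < p.2.2 then X 1 else 1)
  else if p.2.1 < p.1 then (if p.2.2 < p.2.1 then X 2 else 1) else 1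

/-- The weight of the linear word `p q r₁ r₂ …`, all interior letters contributing. -/
noncomputable def linearWt : ℕ → ℕ → List ℕ → WeightRing
  | _, _, [] => 1
  | p, q, r :: rest => tripleWt (p, q, r) * linearWt q r rest

/-- The sum of the weights of the words obtained from `p q r₁ … r_m` by inserting `N` in a slot
to the right of `q` and to the left of `r_m`. -/
noncomputable def insertWt (N : ℕ) : ℕ → ℕ → List ℕ → WeightRing
  | _, _, [] => 0
  | p, q, r :: rest =>
      linearWt p q (N :: r :: rest) + tripleWt (p, q, r) * insertWt N q r rest

/-- The word `p q r₁ … r_m` has no plateau and ends with a descent. -/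
def EndsDescending : ℕ → ℕ → List ℕ → Prop
  | p, q, [] => q < p
  | p, q, r :: rest => p ≠ q ∧ EndsDescending q r rest

theorem linearWt_congr_left {p p' q : ℕ} (rest : List ℕ) (h : q < p) (h' : q < p') :
    linearWt p q rest = linearWt p' q rest := by
  cases rest with
  | nil => rfl
  | cons r rest => simp [linearWt, tripleWt, h, h', h.not_gt, h'.not_gt]

theorem insertWt_eq_grammarD (N : ℕ) (rest : List ℕ) : ∀ p q : ℕ, EndsDescending p q rest →
    q < N → (∀ r ∈ rest, r < N) →
    insertWt N p q rest + (if p < q then X 0 * linearWt N q rest else 0)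
      = grammarD (linearWt p q rest) := by
  induction rest with
  | nil =>
    intro p q h _ _
    have h' : q < p := h
    simp [insertWt, linearWt, h'.not_gt]
  | cons r rest ih =>
    intro p q h hq hr
    obtain ⟨hpq, hd⟩ := h
    have hrN : r < N := hr r (by simp)
    have key := ih q r hd hrN (fun x hx => hr x (by simp [hx]))
    have hqr : q ≠ r := by
      cases rest with
      | nil => exact fun e => by subst e; exact lt_irrefl _ hd
      | cons => exact hd.1
    simp only [linearWt, insertWt, Derivation.leibniz, ← key, smul_eq_mul]
    rcases lt_or_gt_of_ne hpq with h1 | h1 <;> rcases lt_or_gt_of_ne hqr with h2 | h2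
    · simp [tripleWt, h1, h2, hq, hrN, h2.not_gt, hq.not_gt, grammarD_X1]
      ring
    · rw [linearWt_congr_left rest hrN h2]
      simp [tripleWt, h1, h2, hq, hrN, h2.not_gt, hq.not_gt, grammarD_X0]
      ring
    · simp [tripleWt, h1, h2, hq, hrN, h1.not_gt, h2.not_gt, hq.not_gt]
      ring
    · rw [linearWt_congr_left rest hrN h2]
      simp [tripleWt, h1, h2, hq, hrN, h1.not_gt, h2.not_gt, hq.not_gt, grammarD_X2]
      ring

/-- All the lists obtained by inserting `x` into a list. -/
def insertAll {α : Type*} (x : α) : List α → List (List α)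
  | [] => [[x]]
  | y :: l => (x :: y :: l) :: (insertAll x l).map (y :: ·)

theorem mem_insertAll {α : Type*} {x : α} {l l' : List α} :
    l' ∈ insertAll x l ↔ ∃ l₁ l₂, l = l₁ ++ l₂ ∧ l' = l₁ ++ x :: l₂ := by
  induction l generalizing l' with
  | nil => simp [insertAll]
  | cons y l ih =>
    simp only [insertAll, List.mem_cons, List.mem_map, ih]
    constructor
    · rintro (rfl | ⟨_, ⟨l₁, l₂, rfl, rfl⟩, rfl⟩)
      · exact ⟨[], y :: l, rfl, rfl⟩
      · exact ⟨y :: l₁, l₂, rfl, rfl⟩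
    · rintro ⟨l₁, l₂, h, rfl⟩
      cases l₁ with
      | nil => exact Or.inl (by simpa using h.symm)
      | cons w l₁ =>
        simp only [List.cons_append, List.cons.injEq] at h
        obtain ⟨rfl, rfl⟩ := h
        exact Or.inr ⟨_, ⟨l₁, l₂, rfl, rfl⟩, rfl⟩

theorem map_insertAll {α β : Type*} (f : α → β) (x : α) (l : List α) :
    (insertAll x l).map (List.map f) = insertAll (f x) (l.map f) := by
  induction l with
  | nil => rfl
  | cons y l ih =>
    simp only [insertAll, List.map_cons, List.map_map, ← ih]
    rfl

theorem nodup_insertAll {α : Type*} {x : α} {l : List α} (h : x ∉ l) :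
    (insertAll x l).Nodup := by
  induction l with
  | nil => simp [insertAll]
  | cons y l ih =>
    simp only [List.mem_cons, not_or] at h
    refine List.nodup_cons.2 ⟨?_, (ih h.2).map fun _ _ e => (List.cons.inj e).2⟩
    simp [Ne.symm h.1]

theorem sum_linearWt_insertAll (N a : ℕ) (l : List ℕ) : ∀ p q : ℕ,
    ((insertAll N l).map fun l' => linearWt p q (l' ++ [a])).sum
      = insertWt N p q (l ++ [a]) := by
  induction l with
  | nil => simp [insertAll, insertWt]
  | cons y l ih =>
    intro p q
    simp only [insertAll, List.map_cons, List.sum_cons, List.map_map, Function.comp_def,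
      List.cons_append, insertWt, ← ih]
    rw [← List.sum_map_mul_left]
    rfl

/-- The weight of a word read cyclically. -/
noncomputable def wordWt (w : List ℕ) : WeightRing :=
  X 0 ^ cpeakW w * X 1 ^ dcascW w * X 2 ^ dcdesW w * X 3 ^ (if w.tail.isEmpty then 1 else 0)

theorem prod_map_tripleWt (l : List (ℕ × ℕ × ℕ)) :
    (l.map tripleWt).prod =
      X 0 ^ (l.countP fun p => decide (p.1 < p.2.1 ∧ p.2.2 < p.2.1)) *
      X 1 ^ (l.countP fun p => decide (p.1 < p.2.1 ∧ p.2.1 < p.2.2)) *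
      X 2 ^ (l.countP fun p => decide (p.2.1 < p.1 ∧ p.2.2 < p.2.1)) := by
  induction l with
  | nil => simp
  | cons p l ih =>
    obtain ⟨a, b, c⟩ := p
    simp only [List.map_cons, List.prod_cons, ih, List.countP_cons, tripleWt]
    rcases lt_trichotomy a b with h1 | h1 | h1 <;> rcases lt_trichotomy b c with h2 | h2 | h2 <;>
      simp [h1, h2, h1.not_gt, h2.not_gt, pow_succ] <;> ring

theorem linearWt_eq_prod (rest : List ℕ) : ∀ p q : ℕ,
    linearWt p q rest = (((p :: q :: rest).zip ((q :: rest).zip rest)).map tripleWt).prod := by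
  induction rest with
  | nil => simp [linearWt]
  | cons r rest ih => intro p q; simp [linearWt, ih]

theorem cycTriples_cons (a y : ℕ) (v : List ℕ) :
    cycTriples (a :: (v ++ [y]))
      = (y :: a :: (v ++ [y, a])).zip ((a :: (v ++ [y, a])).zip (v ++ [y, a])) := by
  have h1 : (a :: (v ++ [y])).rotate ((a :: (v ++ [y])).length - 1) = y :: a :: v := by simp
  have h2 : (a :: (v ++ [y])).rotate 1 = v ++ [y, a] := by simp
  rw [cycTriples, h1, h2]
  have e1 : (a :: (v ++ [y, a])).zip (v ++ [y, a]) = (a :: (v ++ [y])).zip (v ++ [y, a]) := by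
    have : a :: (v ++ [y, a]) = (a :: (v ++ [y])) ++ [a] := by simp
    rw [this]
    conv_lhs => rw [← List.append_nil (v ++ [y, a])]
    rw [List.zip_append (by simp)]
    simp
  rw [e1]
  have : y :: a :: (v ++ [y, a]) = (y :: a :: v) ++ [y, a] := by simp
  rw [this]
  conv_rhs => rw [← List.append_nil ((a :: (v ++ [y])).zip (v ++ [y, a]))]
  rw [List.zip_append (by simp)]
  simp

theorem wordWt_eq_linearWt {a N : ℕ} {v : List ℕ} (hv : v ≠ []) (ha : ∀ x ∈ v, a < x)
    (hN : a < N) : wordWt (a :: v) = linearWt N a (v ++ [a]) := by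
  obtain ⟨v, y, rfl⟩ := List.eq_nil_or_concat v |>.resolve_left hv
  rw [List.concat_eq_append] at *
  have hy : a < y := ha y (by simp)
  rw [linearWt_congr_left _ hN hy, linearWt_eq_prod]
  have := prod_map_tripleWt (cycTriples (a :: (v ++ [y])))
  rw [cycTriples_cons] at this
  simp only [List.append_assoc, List.cons_append, List.nil_append]
  rw [this, ← cycTriples_cons]
  simp [wordWt, cpeakW, dcascW, dcdesW]

theorem endsDescending_append {a : ℕ} {v : List ℕ} (hv : v ≠ []) : ∀ {p q : ℕ},
    (∀ x ∈ v, a < x) → p ≠ q → (q :: v).Nodup → EndsDescending p q (v ++ [a]) := by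
  induction v with
  | nil => exact absurd rfl hv
  | cons x v ih =>
    intro p q ha hpq hnd
    refine ⟨hpq, ?_⟩
    have hqx : q ≠ x := fun e => by simp [e] at hnd
    cases v with
    | nil => exact ⟨hqx, ha x (by simp)⟩
    | cons x' v =>
      exact ih (by simp) (fun z hz => ha z (by simp [hz])) hqx (List.nodup_cons.1 hnd).2

theorem sum_wordWt_insertAll {a N : ℕ} {v : List ℕ} (ha : ∀ x ∈ v, a < x) (hnd : v.Nodup)
    (haN : a < N) (hN : ∀ x ∈ v, x < N) :
    ((insertAll N v).map fun v' => wordWt (a :: v')).sum = grammarD (wordWt (a :: v)) := by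
  have h1 : ((insertAll N v).map fun v' => wordWt (a :: v'))
      = (insertAll N v).map fun v' => linearWt N a (v' ++ [a]) := by
    refine List.map_congr_left fun v' hv' => ?_
    obtain ⟨l₁, l₂, rfl, rfl⟩ := mem_insertAll.1 hv'
    refine wordWt_eq_linearWt (by simp) (fun x hx => ?_) haN
    simp only [List.mem_append, List.mem_cons] at hx
    rcases hx with hx | rfl | hx
    · exact ha x (by simp [hx])
    · exact haN
    · exact ha x (by simp [hx])
  rw [h1, sum_linearWt_insertAll]
  by_cases hv : v = []
  · subst hv
    simp [insertWt, linearWt, wordWt, cpeakW, dcascW, dcdesW, cycTriples, tripleWt, haN,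
      haN.not_gt, grammarD_X3]
  · rw [wordWt_eq_linearWt hv ha haN, ← insertWt_eq_grammarD N _ N a
      (endsDescending_append hv ha haN.ne' (List.nodup_cons.2 ⟨fun h => (ha a h).false, hnd⟩)) haN
      (by simpa [or_imp, forall_and, haN] using hN)]
    simp [haN.not_gt]

/-! ### Trees -/

namespace LTree

theorem children_induction {P : LTree → Prop}
    (h : ∀ a ts, (∀ s ∈ ts, P s) → P (node a ts)) : ∀ T, P T
  | node a ts => h a ts fun s _hs => children_induction h s
decreasing_by exact sizeOf_lt_of_mem _hs

theorem labels_node (a : ℕ) (ts : List LTree) :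
    labels (node a ts) = a ::ₘ (ts.map labels).sum := by
  rw [labels, List.attach_map_val (l := ts) (f := labels)]

theorem cdes_node (a : ℕ) (ts : List LTree) :
    cdes (node a ts) = cdesW (a :: ts.map label) + (ts.map cdes).sum := by
  rw [cdes, List.attach_map_val (l := ts) (f := cdes)]

theorem casc_node (a : ℕ) (ts : List LTree) :
    casc (node a ts) = cascW (a :: ts.map label) + (ts.map casc).sum := by
  rw [casc, List.attach_map_val (l := ts) (f := casc)]

theorem eleafAux_node (a : ℕ) (ts : List LTree) (b : Bool) :
    eleafAux (node a ts) b = (cond b (if ts.isEmpty then 1 else 0) 0)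
      + (ts.map fun s => eleafAux s !b).sum := by
  rw [eleafAux, List.attach_map_val (l := ts) (f := fun s => eleafAux s !b)]

theorem evenSum_node (f : List ℕ → ℕ) (a : ℕ) (ts : List LTree) (b : Bool) :
    evenSum f (node a ts) b = (cond b (f (a :: ts.map label)) 0)
      + (ts.map fun s => evenSum f s !b).sum := by
  rw [evenSum, List.attach_map_val (l := ts) (f := fun s => evenSum f s !b)]

theorem oddOK_node (k : ℕ → ℕ) (a : ℕ) (ts : List LTree) (b : Bool) :
    oddOK k (node a ts) b ↔ (b = false → (ts.length = k a - 1 ∧ ∀ s ∈ ts, s.label = a)) ∧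
      ∀ s ∈ ts, oddOK k s !b := by
  rw [oddOK, Subtype.forall]

theorem incr_node (a : ℕ) (ts : List LTree) :
    incr (node a ts) ↔ (∀ s ∈ ts, a ≤ s.label) ∧ ∀ s ∈ ts, incr s := by
  rw [incr, Subtype.forall]

theorem label_node (a : ℕ) (ts : List LTree) : label (node a ts) = a := rfl

theorem label_mem_labels (T : LTree) : T.label ∈ T.labels := by
  cases T with
  | node a ts => simp [labels_node, label_node]

theorem labels_le_of_mem {s : LTree} {ts : List LTree} (h : s ∈ ts) (a : ℕ) :
    s.labels ≤ (node a ts).labels := by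
  rw [labels_node]
  refine le_trans ?_ (Multiset.le_cons_self _ _)
  exact List.single_le_sum (fun _ _ => Multiset.zero_le _) _ (List.mem_map_of_mem h)

/-- Insertions of the tree `B` as a new child of an even vertex of a tree; the Boolean is `true`
when the root is considered to be at even level. -/
def ins (B : LTree) : LTree → Bool → List LTree
  | node a ts, b => (cond b ((insertAll B ts).map (node a)) []) ++ (insL ts !b).map (node a)
where
  /-- Insertions of `B` into exactly one tree of a list of trees. -/
  insL : List LTree → Bool → List (List LTree)
  | [], _ => []
  | t :: ts, b => (ins B t b).map (· :: ts) ++ (insL ts b).map (t :: ·)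

theorem mem_insL {B : LTree} {ts l : List LTree} {b : Bool} : l ∈ ins.insL B ts b ↔
    ∃ l₁ s l₂ s', ts = l₁ ++ s :: l₂ ∧ s' ∈ ins B s b ∧ l = l₁ ++ s' :: l₂ := by
  induction ts generalizing l with
  | nil => simp [ins.insL]
  | cons t ts ih =>
    simp only [ins.insL, List.mem_append, List.mem_map, ih]
    constructor
    · rintro (⟨s', hs', rfl⟩ | ⟨_, ⟨l₁, s, l₂, s', rfl, hs', rfl⟩, rfl⟩)
      · exact ⟨[], t, ts, s', rfl, hs', rfl⟩
      · exact ⟨t :: l₁, s, l₂, s', rfl, hs', rfl⟩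
    · rintro ⟨l₁, s, l₂, s', h, hs', rfl⟩
      cases l₁ with
      | nil =>
        simp only [List.nil_append, List.cons.injEq] at h
        obtain ⟨rfl, rfl⟩ := h
        exact Or.inl ⟨s', hs', rfl⟩
      | cons w l₁ =>
        simp only [List.cons_append, List.cons.injEq] at h
        obtain ⟨rfl, rfl⟩ := h
        exact Or.inr ⟨_, ⟨l₁, s, l₂, s', rfl, hs', rfl⟩, rfl⟩

theorem mem_ins_node {B T' : LTree} {a : ℕ} {ts : List LTree} {b : Bool} :
    T' ∈ ins B (node a ts) b ↔
      (b = true ∧ ∃ l₁ l₂, ts = l₁ ++ l₂ ∧ T' = node a (l₁ ++ B :: l₂)) ∨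
      ∃ l₁ s l₂ s', ts = l₁ ++ s :: l₂ ∧ s' ∈ ins B s (!b) ∧ T' = node a (l₁ ++ s' :: l₂) := by
  have h1 : T' ∈ (ins.insL B ts !b).map (node a) ↔ ∃ l₁ s l₂ s',
      ts = l₁ ++ s :: l₂ ∧ s' ∈ ins B s (!b) ∧ T' = node a (l₁ ++ s' :: l₂) := by
    simp only [List.mem_map, mem_insL]
    constructor
    · rintro ⟨_, ⟨l₁, s, l₂, s', rfl, hs', rfl⟩, rfl⟩
      exact ⟨l₁, s, l₂, s', rfl, hs', rfl⟩
    · rintro ⟨l₁, s, l₂, s', rfl, hs', rfl⟩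
      exact ⟨_, ⟨l₁, s, l₂, s', rfl, hs', rfl⟩, rfl⟩
  have h2 : T' ∈ (insertAll B ts).map (node a) ↔
      ∃ l₁ l₂, ts = l₁ ++ l₂ ∧ T' = node a (l₁ ++ B :: l₂) := by
    simp only [List.mem_map, mem_insertAll]
    constructor
    · rintro ⟨_, ⟨l₁, l₂, rfl, rfl⟩, rfl⟩
      exact ⟨l₁, l₂, rfl, rfl⟩
    · rintro ⟨l₁, l₂, rfl, rfl⟩
      exact ⟨_, ⟨l₁, l₂, rfl, rfl⟩, rfl⟩
  rw [ins, List.mem_append, h1]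
  cases b
  · simp
  · simp [h2]

theorem label_of_mem_ins {B T T' : LTree} {b : Bool} (h : T' ∈ ins B T b) :
    T'.label = T.label := by
  cases T with
  | node a ts =>
    rcases mem_ins_node.1 h with ⟨_, _, _, _, rfl⟩ | ⟨_, _, _, _, _, _, rfl⟩ <;> rfl

theorem map_label_of_mem_insL {B : LTree} {ts l : List LTree} {b : Bool}
    (h : l ∈ ins.insL B ts b) : l.map label = ts.map label := by
  obtain ⟨l₁, s, l₂, s', rfl, hs', rfl⟩ := mem_insL.1 h
  simp [label_of_mem_ins hs']

theorem labels_of_mem_ins {B T : LTree} : ∀ {T' : LTree} {b : Bool}, T' ∈ ins B T b →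
    T'.labels = T.labels + B.labels := by
  induction T using children_induction with
  | h a ts ih =>
    intro T' b h
    rcases mem_ins_node.1 h with ⟨_, l₁, l₂, rfl, rfl⟩ | ⟨l₁, s, l₂, s', rfl, hs', rfl⟩
    · simp only [labels_node, List.map_append, List.map_cons, List.sum_append, List.sum_cons,
        ← Multiset.singleton_add]
      abel
    · simp only [labels_node, List.map_append, List.map_cons, List.sum_append, List.sum_cons,
        ih s (by simp) hs', ← Multiset.singleton_add]
      abel

theorem oddOK_of_mem_ins {k : ℕ → ℕ} {B T : LTree} (hB : B.oddOK k false) :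
    ∀ {T' : LTree} {b : Bool}, T' ∈ ins B T b → T.oddOK k b → T'.oddOK k b := by
  induction T using children_induction with
  | h a ts ih =>
    intro T' b h hT
    rw [oddOK_node] at hT
    rcases mem_ins_node.1 h with ⟨rfl, l₁, l₂, rfl, rfl⟩ | ⟨l₁, s, l₂, s', rfl, hs', rfl⟩
    · rw [oddOK_node]
      refine ⟨by simp, fun s hs => ?_⟩
      simp only [List.mem_append, List.mem_cons] at hs
      rcases hs with hs | rfl | hs
      · exact hT.2 s (by simp [hs])
      · exact hB
      · exact hT.2 s (by simp [hs])
    · rw [oddOK_node]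
      refine ⟨fun hb => ⟨by simpa using (hT.1 hb).1, fun r hr => ?_⟩, fun r hr => ?_⟩
      · simp only [List.mem_append, List.mem_cons] at hr
        rcases hr with hr | rfl | hr
        · exact (hT.1 hb).2 r (by simp [hr])
        · rw [label_of_mem_ins hs']; exact (hT.1 hb).2 s (by simp)
        · exact (hT.1 hb).2 r (by simp [hr])
      · simp only [List.mem_append, List.mem_cons] at hr
        rcases hr with hr | rfl | hr
        · exact hT.2 r (by simp [hr])
        · exact ih s (by simp) hs' (hT.2 s (by simp))
        · exact hT.2 r (by simp [hr])

theorem incr_of_mem_ins {B T : LTree} (hB : B.incr) :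
    ∀ {T' : LTree} {b : Bool}, T' ∈ ins B T b → (∀ x ∈ T.labels, x < B.label) → T.incr →
      T'.incr := by
  induction T using children_induction with
  | h a ts ih =>
    intro T' b h hlt hT
    rw [incr_node] at hT
    rcases mem_ins_node.1 h with ⟨rfl, l₁, l₂, rfl, rfl⟩ | ⟨l₁, s, l₂, s', rfl, hs', rfl⟩
    · rw [incr_node, ← forall₂_and]
      intro r hr
      simp only [List.mem_append, List.mem_cons] at hr
      rcases hr with hr | rfl | hr
      · exact ⟨hT.1 r (by simp [hr]), hT.2 r (by simp [hr])⟩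
      · exact ⟨(hlt a (by simp [labels_node])).le, hB⟩
      · exact ⟨hT.1 r (by simp [hr]), hT.2 r (by simp [hr])⟩
    · rw [incr_node, ← forall₂_and]
      intro r hr
      simp only [List.mem_append, List.mem_cons] at hr
      rcases hr with hr | rfl | hr
      · exact ⟨hT.1 r (by simp [hr]), hT.2 r (by simp [hr])⟩
      · refine ⟨?_, ih s (by simp) hs' (fun x hx => hlt x ?_) (hT.2 s (by simp))⟩
        · rw [label_of_mem_ins hs']; exact hT.1 s (by simp)
        · exact Multiset.mem_of_le (labels_le_of_mem (by simp) a) hx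
      · exact ⟨hT.1 r (by simp [hr]), hT.2 r (by simp [hr])⟩

/-- The local structure of weakly increasing trees: the children of an even vertex have distinct
labels exceeding the label of the vertex, and the children of an odd vertex share its label. -/
inductive Nice : Bool → LTree → Prop
  | even {a : ℕ} {ts : List LTree} : (∀ s ∈ ts, a < s.label) → (ts.map label).Nodup →
      (∀ s ∈ ts, Nice false s) → Nice true (node a ts)
  | odd {a : ℕ} {ts : List LTree} : (∀ s ∈ ts, s.label = a) →
      (∀ s ∈ ts, Nice true s) → Nice false (node a ts)

theorem nice_of_mem_ins {B T : LTree} (hB : Nice false B) :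
    ∀ {T' : LTree} {b : Bool}, T' ∈ ins B T b → (∀ x ∈ T.labels, x < B.label) → Nice b T →
      Nice b T' := by
  induction T using children_induction with
  | h a ts ih =>
    intro T' b h hlt hT
    rcases mem_ins_node.1 h with ⟨rfl, l₁, l₂, rfl, rfl⟩ | ⟨l₁, s, l₂, s', rfl, hs', rfl⟩
    · cases hT with
      | even h1 h2 h3 =>
        have hlt' : ∀ r ∈ l₁ ++ l₂, r.label < B.label := fun r hr =>
          hlt _ (Multiset.mem_of_le (labels_le_of_mem hr a) r.label_mem_labels)
        refine .even ?_ ?_ ?_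
        · intro r hr
          simp only [List.mem_append, List.mem_cons] at hr
          rcases hr with hr | rfl | hr
          · exact h1 r (by simp [hr])
          · exact hlt a (by simp [labels_node])
          · exact h1 r (by simp [hr])
        · rw [List.map_append, List.map_cons, List.nodup_middle, ← List.map_append,
            List.nodup_cons]
          refine ⟨fun hm => ?_, h2⟩
          obtain ⟨r, hr, e⟩ := List.mem_map.1 hm
          exact (hlt' r hr).ne e
        · intro r hr
          simp only [List.mem_append, List.mem_cons] at hr
          rcases hr with hr | rfl | hr
          · exact h3 r (by simp [hr])
          · exact hB
          · exact h3 r (by simp [hr])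
    · have hs : ∀ {c : Bool}, s' ∈ ins B s c → Nice c s → Nice c s' := fun h1 h2 =>
        ih s (by simp) h1
          (fun x hx => hlt x (Multiset.mem_of_le (labels_le_of_mem (by simp) a) hx)) h2
      have hl := label_of_mem_ins hs'
      cases hT with
      | even h1 h2 h3 =>
        refine .even ?_ (by simpa [hl] using h2) ?_
        · simpa [or_imp, forall_and, hl] using h1
        · have h4 := hs hs' (h3 s (by simp))
          simp only [List.mem_append, List.mem_cons, or_imp, forall_and, forall_eq] at h3 ⊢
          exact ⟨h3.1, h4, h3.2.2⟩
      | odd h1 h3 =>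
        refine .odd ?_ ?_
        · simpa [or_imp, forall_and, hl] using h1
        · have h4 := hs hs' (h3 s (by simp))
          simp only [List.mem_append, List.mem_cons, or_imp, forall_and, forall_eq] at h3 ⊢
          exact ⟨h3.1, h4, h3.2.2⟩

/-- Delete every non-root vertex labeled `N` together with its descendants. -/
def del (N : ℕ) : LTree → LTree
  | node a ts => node a ((ts.attach.map fun s => del N s.1).filter fun s => decide (s.label ≠ N))
decreasing_by exact sizeOf_lt_of_mem s.2

theorem del_node (N a : ℕ) (ts : List LTree) :
    del N (node a ts) = node a ((ts.map (del N)).filter fun s => decide (s.label ≠ N)) := by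
  rw [del, List.attach_map_val (l := ts) (f := (del N))]

theorem label_del (N : ℕ) (T : LTree) : (del N T).label = T.label := by
  cases T with
  | node a ts => rw [del_node]; rfl

theorem label_ne_of_notMem {N a : ℕ} {ts : List LTree} (h : N ∉ (node a ts).labels) {s : LTree}
    (hs : s ∈ ts) : s.label ≠ N := fun e =>
  h (e ▸ Multiset.mem_of_le (labels_le_of_mem hs a) s.label_mem_labels)

theorem filter_label_ne {N a : ℕ} {ts : List LTree} (h : N ∉ (node a ts).labels) :
    (ts.filter fun s => decide (s.label ≠ N)) = ts :=
  List.filter_eq_self.2 fun _ hs => decide_eq_true (label_ne_of_notMem h hs)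

theorem del_of_notMem {N : ℕ} {T : LTree} (h : N ∉ T.labels) : del N T = T := by
  induction T using children_induction with
  | h a ts ih =>
    have h1 : ts.map (del N) = ts := by
      conv_rhs => rw [← List.map_id ts]
      exact List.map_congr_left fun s hs => ih s hs fun hm =>
        h (Multiset.mem_of_le (labels_le_of_mem hs a) hm)
    rw [del_node, h1, filter_label_ne h]

theorem del_of_mem_ins {N : ℕ} {B T : LTree} (hB : B.label = N) : ∀ {T' : LTree} {b : Bool},
    T' ∈ ins B T b → N ∉ T.labels → del N T' = T := by
  induction T using children_induction with
  | h a ts ih =>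
    intro T' b h hN
    have hN' : ∀ s ∈ ts, N ∉ s.labels := fun s hs hm =>
      hN (Multiset.mem_of_le (labels_le_of_mem hs a) hm)
    have hmap : ∀ l : List LTree, (∀ s ∈ l, s ∈ ts) → l.map (del N) = l := fun l hl => by
      conv_rhs => rw [← List.map_id l]
      exact List.map_congr_left fun s hs => del_of_notMem (hN' s (hl s hs))
    rcases mem_ins_node.1 h with ⟨rfl, l₁, l₂, rfl, rfl⟩ | ⟨l₁, s, l₂, s', rfl, hs', rfl⟩
    · have := filter_label_ne hN
      rw [List.filter_append] at this
      rw [del_node, List.map_append, List.map_cons, hmap l₁ (by simp +contextual),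
        hmap l₂ (by simp +contextual), List.filter_append, List.filter_cons_of_neg, this]
      simp [label_del, hB]
    · rw [del_node, List.map_append, List.map_cons, hmap l₁ (by simp +contextual),
        hmap l₂ (by simp +contextual), ih s (by simp) hs' (hN' s (by simp)), filter_label_ne hN]

theorem nodup_insL {B : LTree} {ts : List LTree} {b : Bool}
    (h1 : ∀ s ∈ ts, (ins B s b).Nodup) : (ins.insL B ts b).Nodup := by
  induction ts with
  | nil => simp [ins.insL]
  | cons t ts ih =>
    rw [ins.insL, List.nodup_append']
    refine ⟨(h1 t (by simp)).map fun _ _ e => (List.cons.inj e).1,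
      (ih fun s hs => h1 s (by simp [hs])).map fun _ _ e => (List.cons.inj e).2, ?_⟩
    intro l hl hl'
    obtain ⟨t', ht', rfl⟩ := List.mem_map.1 hl
    obtain ⟨l, _, e⟩ := List.mem_map.1 hl'
    have := labels_of_mem_ins ht'
    rw [← (List.cons.inj e).1, left_eq_add] at this
    have h2 := B.label_mem_labels
    simp [this] at h2

theorem nodup_ins {B T : LTree} : ∀ {b : Bool}, B.label ∉ T.labels → (ins B T b).Nodup := by
  induction T using children_induction with
  | h a ts ih =>
    intro b h
    have hinj : Function.Injective (node a) := fun _ _ e => (node.inj e).2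
    have h1 : ∀ {c}, ((ins.insL B ts c).map (node a)).Nodup :=
      (nodup_insL fun s hs => ih s hs fun hm =>
        h (Multiset.mem_of_le (labels_le_of_mem hs a) hm)).map hinj
    rw [ins]
    cases b with
    | false => simpa using h1
    | true =>
      rw [cond_true, List.nodup_append']
      refine ⟨(nodup_insertAll fun hB => label_ne_of_notMem h hB rfl).map hinj, h1, ?_⟩
      intro T hT hT'
      obtain ⟨l, hl, rfl⟩ := List.mem_map.1 hT
      obtain ⟨l', hl', e⟩ := List.mem_map.1 hT'
      obtain rfl := hinj e
      obtain ⟨l₁, l₂, rfl, rfl⟩ := mem_insertAll.1 hl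
      have hlab := map_label_of_mem_insL hl'
      have : B.label ∈ (l₁ ++ l₂).map label := by rw [← hlab]; simp
      obtain ⟨s, hs, e⟩ := List.mem_map.1 this
      exact label_ne_of_notMem h hs e

/-! ### Weights of trees -/

/-- The weight of a tree whose root is at even level if and only if `b` holds. -/
noncomputable def treeWt (b : Bool) (T : LTree) : WeightRing :=
  X 0 ^ evenSum cpeakW T b * X 1 ^ evenSum dcascW T b * X 2 ^ evenSum dcdesW T b
    * X 3 ^ eleafAux T b

theorem prod_map_treeWt (b : Bool) (ts : List LTree) : (ts.map (treeWt b)).prod =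
    X 0 ^ (ts.map fun s => evenSum cpeakW s b).sum * X 1 ^ (ts.map fun s => evenSum dcascW s b).sum
      * X 2 ^ (ts.map fun s => evenSum dcdesW s b).sum
      * X 3 ^ (ts.map fun s => eleafAux s b).sum := by
  induction ts with
  | nil => simp
  | cons t ts ih =>
    simp only [List.map_cons, List.prod_cons, List.sum_cons, ih, treeWt, pow_add]
    ring

theorem treeWt_node_true (a : ℕ) (ts : List LTree) : treeWt true (node a ts) =
    wordWt (a :: ts.map label) * (ts.map (treeWt false)).prod := by
  rw [prod_map_treeWt]
  simp only [treeWt, wordWt, evenSum_node, eleafAux_node, cond_true, Bool.not_true, pow_add,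
    List.tail_cons, List.isEmpty_map]
  ring

theorem treeWt_node_false (a : ℕ) (ts : List LTree) : treeWt false (node a ts) =
    (ts.map (treeWt true)).prod := by
  rw [prod_map_treeWt]
  simp only [treeWt, evenSum_node, eleafAux_node, cond_false, Bool.not_false, zero_add]

theorem sum_treeWt_insL {B : LTree} {c : WeightRing} {b : Bool} {ts : List LTree}
    (h : ∀ s ∈ ts, ((ins B s b).map (treeWt b)).sum = c * grammarD (treeWt b s)) :
    ((ins.insL B ts b).map fun l => (l.map (treeWt b)).prod).sum
      = c * grammarD (ts.map (treeWt b)).prod := by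
  induction ts with
  | nil => simp [ins.insL]
  | cons t ts ih =>
    have h1 := h t (by simp)
    have h2 := ih fun s hs => h s (by simp [hs])
    simp only [ins.insL, List.map_append, List.map_map, Function.comp_def, List.map_cons,
      List.prod_cons, List.sum_append, List.sum_map_mul_left, List.sum_map_mul_right, h1, h2,
      Derivation.leibniz, smul_eq_mul]
    ring

theorem sum_treeWt_insertAll {a : ℕ} {B : LTree} {ts : List LTree} (h1 : ∀ s ∈ ts, a < s.label)
    (h2 : (ts.map label).Nodup) (h3 : a < B.label) (h4 : ∀ s ∈ ts, s.label < B.label) :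
    ((insertAll B ts).map fun l => treeWt true (node a l)).sum
      = grammarD (wordWt (a :: ts.map label))
          * (treeWt false B * (ts.map (treeWt false)).prod) := by
  have key := sum_wordWt_insertAll (a := a) (N := B.label) (v := ts.map label)
    (by simpa using h1) h2 h3 (by simpa using h4)
  rw [← map_insertAll, List.map_map] at key
  rw [← key, ← List.sum_map_mul_right]
  refine congrArg List.sum (List.map_congr_left fun l hl => ?_)
  obtain ⟨l₁, l₂, rfl, rfl⟩ := mem_insertAll.1 hl
  rw [treeWt_node_true]
  simp only [Function.comp_apply, List.map_append, List.map_cons, List.prod_append,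
    List.prod_cons]
  ring

theorem sum_treeWt_ins {B T : LTree} : ∀ {b : Bool}, Nice b T →
    (∀ x ∈ T.labels, x < B.label) →
    ((ins B T b).map (treeWt b)).sum = treeWt false B * grammarD (treeWt b T) := by
  induction T using children_induction with
  | h a ts ih =>
    intro b hT hlt
    have hlt' : ∀ s ∈ ts, ∀ x ∈ s.labels, x < B.label := fun s hs x hx =>
      hlt x (Multiset.mem_of_le (labels_le_of_mem hs a) hx)
    cases hT with
    | odd h1 h3 =>
      have := sum_treeWt_insL (B := B) fun s hs => ih s hs (h3 s hs) (hlt' s hs)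
      simp only [ins, cond_false, List.nil_append, Bool.not_false, List.map_map, Function.comp_def,
        treeWt_node_false, this]
    | even h1 h2 h3 =>
      have key := sum_treeWt_insL (B := B) fun s hs => ih s hs (h3 s hs) (hlt' s hs)
      have e1 : ((ins.insL B ts false).map fun l => treeWt true (node a l)).sum
          = wordWt (a :: ts.map label)
            * (treeWt false B * grammarD (ts.map (treeWt false)).prod) := by
        rw [← key, ← List.sum_map_mul_left]
        refine congrArg List.sum (List.map_congr_left fun l hl => ?_)
        rw [treeWt_node_true, map_label_of_mem_insL hl]
      have e2 := sum_treeWt_insertAll h1 h2 (hlt a (by simp [labels_node]))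
        fun s hs => hlt' s hs _ s.label_mem_labels
      simp only [ins, cond_true, Bool.not_true, List.map_append, List.map_map, Function.comp_def,
        List.sum_append]
      rw [e1, e2, treeWt_node_true, Derivation.leibniz, smul_eq_mul, smul_eq_mul]
      ring

/-- The vertex labeled `N` with `m` children, all of them leaves labeled `N`. -/
def bush (N m : ℕ) : LTree := node N (List.replicate m (node N []))

theorem labels_bush (N m : ℕ) : (bush N m).labels = Multiset.replicate (m + 1) N := by
  simp [bush, labels_node, Multiset.replicate_succ, Multiset.nsmul_singleton]

theorem incr_bush (N m : ℕ) : (bush N m).incr := by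
  rw [bush, incr_node, ← forall₂_and]
  intro s hs
  obtain rfl := List.eq_of_mem_replicate hs
  simp [incr_node, label_node]

theorem nice_bush (N m : ℕ) : Nice false (bush N m) := by
  refine .odd (fun s hs => ?_) fun s hs => ?_ <;> obtain rfl := List.eq_of_mem_replicate hs
  · rfl
  · exact .even (by simp) (by simp) (by simp)

theorem oddOK_bush {k : ℕ → ℕ} {N m : ℕ} (h : m = k N - 1) : (bush N m).oddOK k false := by
  rw [bush, oddOK_node]
  refine ⟨fun _ => ⟨by simp [h], fun s hs => ?_⟩, fun s hs => ?_⟩ <;>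
    obtain rfl := List.eq_of_mem_replicate hs
  · rfl
  · simp [oddOK_node]

theorem treeWt_bush (N m : ℕ) : treeWt false (bush N m) = X 3 ^ m := by
  rw [bush, treeWt_node_false]
  simp [treeWt_node_true, wordWt, cpeakW, dcascW, dcdesW, cycTriples]

theorem eleafAux_bush (N m : ℕ) : eleafAux (bush N m) false = m := by
  simp [bush, eleafAux_node]

theorem eleafAux_of_mem_ins {B T : LTree} : ∀ {T' : LTree} {b : Bool}, T' ∈ ins B T b →
    eleafAux T' b ≤ eleafAux T b + eleafAux B false := by
  induction T using children_induction with
  | h a ts ih =>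
    intro T' b h
    rcases mem_ins_node.1 h with ⟨rfl, l₁, l₂, rfl, rfl⟩ | ⟨l₁, s, l₂, s', rfl, hs', rfl⟩
    · simp [eleafAux_node]
      omega
    · have := ih s (by simp) hs'
      simp [eleafAux_node]
      omega

theorem count_labels_node (N a : ℕ) (ts : List LTree) : (node a ts).labels.count N =
    (ts.map fun s => s.labels.count N).sum + if N = a then 1 else 0 := by
  rw [labels_node, Multiset.count_cons]
  congr 1
  have := map_list_sum (Multiset.countAddMonoidHom N) (ts.map labels)
  simpa [Function.comp_def] using this

theorem exists_sum_eq_mul_add {α : Type*} {q c : ℕ} {f : α → ℕ} {l : List α}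
    (h : ∀ x ∈ l, ∃ m, f x = q * m + c) : ∃ m, (l.map f).sum = q * m + l.length * c := by
  induction l with
  | nil => exact ⟨0, by simp⟩
  | cons x l ih =>
    obtain ⟨m₁, h₁⟩ := h x (by simp)
    obtain ⟨m₂, h₂⟩ := ih fun y hy => h y (by simp [hy])
    exact ⟨m₁ + m₂, by simp only [List.map_cons, List.sum_cons, h₁, h₂, List.length_cons]; ring⟩

theorem exists_count_labels {k : ℕ → ℕ} {N : ℕ} (hk : 1 ≤ k N) (T : LTree) : ∀ b : Bool,
    T.oddOK k b → ∃ m, T.labels.count N = k N * m + if b = true ∧ T.label = N then 1 else 0 := by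
  induction T using children_induction with
  | h a ts ih =>
    intro b hT
    rw [oddOK_node] at hT
    rw [count_labels_node]
    cases b with
    | true =>
      obtain ⟨m, hm⟩ := exists_sum_eq_mul_add (c := 0) (q := k N)
        (f := fun s => s.labels.count N) (l := ts)
        fun s hs => by simpa using ih s hs false (hT.2 s hs)
      exact ⟨m, by simp [hm, label_node, eq_comm]⟩
    | false =>
      obtain ⟨hl, ha⟩ := hT.1 rfl
      obtain ⟨m, hm⟩ := exists_sum_eq_mul_add (c := if a = N then 1 else 0) (q := k N)
        (f := fun s => s.labels.count N) (l := ts)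
        fun s hs => by simpa [ha s hs] using ih s hs true (hT.2 s hs)
      by_cases haN : a = N
      · subst haN
        refine ⟨m + 1, ?_⟩
        simp [hm, hl, mul_add]
        omega
      · exact ⟨m, by simp [hm, haN, Ne.symm haN]⟩

theorem le_one_of_sum_le_length {α : Type*} {f : α → ℕ} {l : List α} (h1 : ∀ x ∈ l, 1 ≤ f x)
    (h2 : (l.map f).sum ≤ l.length) {x : α} (hx : x ∈ l) : f x ≤ 1 := by
  obtain ⟨l₁, l₂, rfl⟩ := List.append_of_mem hx
  have g : ∀ l' : List α, (∀ x ∈ l', 1 ≤ f x) → l'.length ≤ (l'.map f).sum := fun l' hl' => by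
    have := List.length_le_sum_of_one_le (l'.map f) (by simpa using hl')
    simpa using this
  have g₁ := g l₁ fun x hx => h1 x (by simp [hx])
  have g₂ := g l₂ fun x hx => h1 x (by simp [hx])
  simp at h2
  omega

theorem eq_bush {k : ℕ → ℕ} {N : ℕ} {s : LTree} (h1 : s.oddOK k false) (h2 : s.incr)
    (h3 : ∀ x ∈ s.labels, x ≤ N) (h4 : s.label = N) (h5 : s.labels.count N ≤ k N) :
    s = bush N (k N - 1) := by
  cases s with
  | node a es =>
    obtain rfl : a = N := h4
    rw [oddOK_node] at h1
    rw [incr_node] at h2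
    obtain ⟨hl, ha⟩ := h1.1 rfl
    rw [count_labels_node, if_pos rfl] at h5
    refine congrArg (node a) (List.eq_replicate_iff.2 ⟨hl, fun e he => ?_⟩)
    have hle := le_one_of_sum_le_length (f := fun s => s.labels.count a) (l := es)
      (fun x hx => Multiset.one_le_count_iff_mem.2 (by simpa [ha x hx] using x.label_mem_labels))
      (by omega) he
    have he3 : ∀ x ∈ e.labels, x ≤ a := fun x hx =>
      h3 x (Multiset.mem_of_le (labels_le_of_mem he a) hx)
    have hei := h2.2 e he
    have hel := ha e he
    cases e with
    | node a' fs =>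
      obtain rfl : a' = a := hel
      cases fs with
      | nil => rfl
      | cons f fs =>
        rw [incr_node] at hei
        have hf1 := hei.1 f (by simp)
        have hf2 := he3 _ (Multiset.mem_of_le (labels_le_of_mem (by simp) a') f.label_mem_labels)
        have hf3 : a' ∈ f.labels := by
          have := f.label_mem_labels
          rwa [le_antisymm hf2 hf1] at this
        have := Multiset.one_le_count_iff_mem.2 hf3
        simp only [count_labels_node, List.map_cons, List.sum_cons, if_true] at hle
        omega

theorem exists_mem_ins {k : ℕ → ℕ} {N : ℕ} (hk : 1 ≤ k N) (T' : LTree) : ∀ {b : Bool},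
    T'.oddOK k b → T'.incr → (∀ x ∈ T'.labels, x ≤ N) → T'.label ≠ N →
    T'.labels.count N = k N →
    ∃ T : LTree, T' ∈ ins (bush N (k N - 1)) T b ∧ T.oddOK k b ∧ T.incr := by
  induction T' using children_induction with
  | h a ts ih =>
    intro b h1 h2 h3 h4 h5
    rw [oddOK_node] at h1
    rw [incr_node] at h2
    have hsub : ∀ s ∈ ts, ∀ x ∈ s.labels, x ≤ N := fun s hs x hx =>
      h3 x (Multiset.mem_of_le (labels_le_of_mem hs a) hx)
    have hcnt : ∀ s ∈ ts, s.labels.count N ≤ k N := fun s hs => by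
      rw [← h5]
      exact Multiset.count_le_of_le _ (labels_le_of_mem hs a)
    by_cases hex : ∃ s ∈ ts, s.label = N
    · obtain ⟨s, hs, hsN⟩ := hex
      obtain rfl : b = true := by
        by_contra hb
        exact h4 (((h1.1 (by simpa using hb)).2 s hs).symm.trans hsN)
      have hsb := eq_bush (h1.2 s hs) (h2.2 s hs) (hsub s hs) hsN (hcnt s hs)
      obtain ⟨l₁, l₂, rfl⟩ := List.append_of_mem hs
      subst hsb
      refine ⟨node a (l₁ ++ l₂), mem_ins_node.2 (Or.inl ⟨rfl, l₁, l₂, rfl, rfl⟩), ?_, ?_⟩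
      · rw [oddOK_node]
        refine ⟨by simp, fun r hr => h1.2 r ?_⟩
        simp only [List.mem_append, List.mem_cons] at hr ⊢
        tauto
      · rw [incr_node]
        refine ⟨fun r hr => h2.1 r ?_, fun r hr => h2.2 r ?_⟩ <;>
        · simp only [List.mem_append, List.mem_cons] at hr ⊢
          tauto
    · push Not at hex
      have haN : N ≠ a := fun e => h4 e.symm
      obtain ⟨s, hs, hs0⟩ : ∃ s ∈ ts, s.labels.count N ≠ 0 := by
        by_contra! hc
        rw [count_labels_node, if_neg haN, List.sum_eq_zero] at h5
        · omega
        · simpa using hc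
      obtain ⟨m, hm⟩ := exists_count_labels hk s _ (h1.2 s hs)
      rw [if_neg fun h => hex s hs h.2, add_zero] at hm
      have hm1 : m = 1 := by
        have := hcnt s hs
        rw [hm] at this hs0
        have h6 : m ≤ 1 := Nat.le_of_mul_le_mul_left (by simpa using this) hk
        have h7 : m ≠ 0 := fun e => hs0 (by simp [e])
        omega
      rw [hm1, mul_one] at hm
      obtain ⟨s₀, hs₀, ho, hi⟩ := ih s hs (h1.2 s hs) (h2.2 s hs) (hsub s hs) (hex s hs) hm
      have hl := label_of_mem_ins hs₀
      obtain ⟨l₁, l₂, rfl⟩ := List.append_of_mem hs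
      refine ⟨node a (l₁ ++ s₀ :: l₂), mem_ins_node.2 (Or.inr ⟨l₁, s₀, l₂, s, rfl, hs₀, rfl⟩),
        ?_, ?_⟩
      · rw [oddOK_node]
        simp only [List.mem_append, List.mem_cons, or_imp, forall_and, forall_eq, hl,
          List.length_append, List.length_cons] at h1 ⊢
        tauto
      · rw [incr_node]
        simp only [List.mem_append, List.mem_cons, or_imp, forall_and, forall_eq, hl] at h2 ⊢
        tauto

end LTree

/-! ### Cyclic statistics of words without repeated letters -/

theorem ne_of_mem_zip_rotate {w : List ℕ} (hw : w.Nodup) (hl : 2 ≤ w.length) {p : ℕ × ℕ}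
    (hp : p ∈ w.zip (w.rotate 1)) : p.1 ≠ p.2 := by
  obtain ⟨i, hi, rfl⟩ := List.mem_iff_getElem.1 hp
  have hi' : i < w.length := by simpa using hi
  simp only [List.getElem_zip, List.getElem_rotate]
  rw [Ne, hw.getElem_inj_iff]
  rcases Nat.lt_or_ge (i + 1) w.length with h | h
  · rw [Nat.mod_eq_of_lt h]; omega
  · rw [show i + 1 = w.length by omega, Nat.mod_self]; omega

theorem zip_rotate_pred (w : List ℕ) :
    (w.rotate (w.length - 1)).zip w = (w.zip (w.rotate 1)).rotate (w.length - 1) := by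
  cases w with
  | nil => rfl
  | cons a v =>
    have h := List.zipWith_rotate_distrib Prod.mk (a :: v) ((a :: v).rotate 1)
      ((a :: v).length - 1) (by simp)
    have e : ((a :: v).rotate 1).rotate ((a :: v).length - 1) = a :: v := by
      rw [List.rotate_rotate, Nat.add_sub_of_le (by simp), List.rotate_length]
    rw [e] at h
    exact h.symm

theorem map_snd_cycTriples (w : List ℕ) :
    (cycTriples w).map Prod.snd = w.zip (w.rotate 1) :=
  List.map_snd_zip (by simp)

theorem map_fst_cycTriples (w : List ℕ) :
    (cycTriples w).map (fun p => (p.1, p.2.1)) = (w.zip (w.rotate 1)).rotate (w.length - 1) := by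
  have h := List.map_fst_zip (l₁ := w) (l₂ := w.rotate 1) (by simp)
  rw [← zip_rotate_pred]
  conv_rhs => rw [← h, List.zip_map_right]
  simp only [cycTriples, h]
  rfl

theorem countP_add_countP {α : Type*} {p q r : α → Bool} {l : List α}
    (h : ∀ x ∈ l, (p x ↔ q x ∨ r x) ∧ ¬ (q x ∧ r x)) :
    l.countP p = l.countP q + l.countP r := by
  induction l with
  | nil => simp
  | cons x l ih =>
    have h1 := h x (by simp)
    have h2 := ih fun y hy => h y (by simp [hy])
    simp only [List.countP_cons, h2]
    cases hq : q x <;> cases hr : r x <;> simp_all <;> omega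

theorem cdesW_eq {w : List ℕ} (hw : w.Nodup) (hl : 2 ≤ w.length) :
    cdesW w = cpeakW w + dcdesW w := by
  rw [cdesW, ← map_snd_cycTriples, List.countP_map, cpeakW, dcdesW]
  refine countP_add_countP fun p hp => ?_
  have h1 : (p.1, p.2.1) ∈ w.zip (w.rotate 1) := by
    have := List.mem_map_of_mem (f := fun p : ℕ × ℕ × ℕ => (p.1, p.2.1)) hp
    rwa [map_fst_cycTriples, List.mem_rotate] at this
  have h2 := ne_of_mem_zip_rotate hw hl h1
  dsimp only at h2
  simp only [Function.comp_apply, decide_eq_true_eq]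
  omega

theorem cascW_eq {w : List ℕ} (hw : w.Nodup) (hl : 2 ≤ w.length) :
    cascW w = cpeakW w + dcascW w := by
  have hperm := List.rotate_perm (w.zip (w.rotate 1)) (w.length - 1)
  rw [cascW, ← hperm.countP_eq, ← map_fst_cycTriples, List.countP_map, cpeakW, dcascW]
  refine countP_add_countP fun p hp => ?_
  have h1 : p.2 ∈ w.zip (w.rotate 1) := by
    have := List.mem_map_of_mem (f := Prod.snd) hp
    rwa [map_snd_cycTriples] at this
  have h2 := ne_of_mem_zip_rotate hw hl h1
  simp only [Function.comp_apply, decide_eq_true_eq]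
  omega

theorem cascW_add_cdesW {w : List ℕ} (hw : w.Nodup) (hl : 2 ≤ w.length) :
    cascW w + cdesW w = w.length := by
  rw [cascW, cdesW, ← countP_add_countP (p := fun _ => true) fun p hp => ?_]
  · simp
  · have := ne_of_mem_zip_rotate hw hl hp
    simp only [decide_eq_true_eq, true_iff]
    omega

theorem cdesW_singleton (a : ℕ) : cdesW [a] = 0 := by simp [cdesW]

theorem cascW_singleton (a : ℕ) : cascW [a] = 0 := by simp [cascW]

theorem cdesW_replicate (m a : ℕ) : cdesW (List.replicate m a) = 0 := by
  simp [cdesW, List.rotate_replicate]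

theorem cascW_replicate (m a : ℕ) : cascW (List.replicate m a) = 0 := by
  simp [cascW, List.rotate_replicate]

theorem one_le_cdesW {a : ℕ} {v : List ℕ} (hv : v ≠ []) (ha : ∀ x ∈ v, a < x) :
    1 ≤ cdesW (a :: v) := by
  obtain ⟨v, y, rfl⟩ := List.eq_nil_or_concat v |>.resolve_left hv
  rw [List.concat_eq_append] at *
  have hy : a < y := ha y (by simp)
  have e : (a :: (v ++ [y])).zip ((a :: (v ++ [y])).rotate 1)
      = (a :: v).zip (v ++ [y]) ++ [(y, a)] := by
    have := List.zip_append (l₁ := a :: v) (r₁ := [y]) (l₂ := v ++ [y]) (r₂ := [a]) (by simp)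
    simpa using this
  rw [cdesW, e, List.countP_append]
  simp [hy]

namespace LTree

theorem sum_map_add {α : Type*} (f g : α → ℕ) (l : List α) :
    (l.map fun x => f x + g x).sum = (l.map f).sum + (l.map g).sum :=
  List.sum_map_add

theorem Nice.nodup_word {a : ℕ} {ts : List LTree} (h1 : ∀ s ∈ ts, a < s.label)
    (h2 : (ts.map label).Nodup) : (a :: ts.map label).Nodup := by
  refine List.nodup_cons.2 ⟨fun h => ?_, h2⟩
  obtain ⟨s, hs, e⟩ := List.mem_map.1 h
  exact (h1 s hs).ne' e

theorem Nice.word_eq_replicate {a : ℕ} {ts : List LTree} (h : ∀ s ∈ ts, s.label = a) :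
    a :: ts.map label = List.replicate (ts.length + 1) a :=
  List.eq_replicate_iff.2 ⟨by simp, by simpa using h⟩

theorem Nice.cdes_eq {T : LTree} : ∀ {b : Bool}, Nice b T →
    T.cdes = evenSum cpeakW T b + evenSum dcdesW T b := by
  induction T using children_induction with
  | h a ts ih =>
    intro b hT
    cases hT with
    | odd h1 h3 =>
      have e : ts.map cdes = ts.map fun s => evenSum cpeakW s true + evenSum dcdesW s true :=
        List.map_congr_left fun s hs => ih s hs (h3 s hs)
      rw [cdes_node, word_eq_replicate h1, cdesW_replicate, evenSum_node, evenSum_node, e,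
        sum_map_add]
      simp
    | even h1 h2 h3 =>
      have e : ts.map cdes = ts.map fun s => evenSum cpeakW s false + evenSum dcdesW s false :=
        List.map_congr_left fun s hs => ih s hs (h3 s hs)
      rw [cdes_node, evenSum_node, evenSum_node, e, sum_map_add, cond_true, cond_true,
        Bool.not_true]
      cases ts with
      | nil => simp [cdesW, cpeakW, dcdesW, cycTriples]
      | cons t ts =>
        rw [cdesW_eq (nodup_word h1 h2) (by simp)]
        ring

theorem Nice.casc_eq {T : LTree} : ∀ {b : Bool}, Nice b T →
    T.casc = evenSum cpeakW T b + evenSum dcascW T b := by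
  induction T using children_induction with
  | h a ts ih =>
    intro b hT
    cases hT with
    | odd h1 h3 =>
      have e : ts.map casc = ts.map fun s => evenSum cpeakW s true + evenSum dcascW s true :=
        List.map_congr_left fun s hs => ih s hs (h3 s hs)
      rw [casc_node, word_eq_replicate h1, cascW_replicate, evenSum_node, evenSum_node, e,
        sum_map_add]
      simp
    | even h1 h2 h3 =>
      have e : ts.map casc = ts.map fun s => evenSum cpeakW s false + evenSum dcascW s false :=
        List.map_congr_left fun s hs => ih s hs (h3 s hs)
      rw [casc_node, evenSum_node, evenSum_node, e, sum_map_add, cond_true, cond_true,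
        Bool.not_true]
      cases ts with
      | nil => simp [cascW, cpeakW, dcascW, cycTriples]
      | cons t ts =>
        rw [cascW_eq (nodup_word h1 h2) (by simp)]
        ring

theorem card_labels_node (a : ℕ) (ts : List LTree) :
    (node a ts).labels.card = (ts.map fun s => s.labels.card).sum + 1 := by
  rw [labels_node, Multiset.card_cons]
  congr 1
  have := map_list_sum Multiset.cardHom (ts.map labels)
  simpa [Function.comp_def] using this

theorem Nice.casc_add_cdes_add_eleafAux {T : LTree} : ∀ {b : Bool}, Nice b T →
    T.casc + T.cdes + eleafAux T b + (if b then 0 else 1) = T.labels.card := by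
  induction T using children_induction with
  | h a ts ih =>
    intro b hT
    cases hT with
    | odd h1 h3 =>
      have e : (ts.map fun s => s.labels.card)
          = ts.map fun s => s.casc + s.cdes + eleafAux s true :=
        List.map_congr_left fun s hs => by simpa using (ih s hs (h3 s hs)).symm
      rw [card_labels_node, e, sum_map_add, sum_map_add, casc_node, cdes_node,
        word_eq_replicate h1, cdesW_replicate, cascW_replicate, eleafAux_node]
      simp
    | even h1 h2 h3 =>
      have e : (ts.map fun s => s.labels.card)
          = ts.map fun s => s.casc + s.cdes + eleafAux s false + 1 :=
        List.map_congr_left fun s hs => by simpa using (ih s hs (h3 s hs)).symm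
      rw [card_labels_node, e, sum_map_add, sum_map_add, sum_map_add, casc_node, cdes_node,
        eleafAux_node, cond_true, Bool.not_true]
      cases ts with
      | nil => simp [cascW_singleton, cdesW_singleton]
      | cons t ts =>
        have := cascW_add_cdesW (nodup_word h1 h2) (by simp)
        simp at this ⊢
        omega

theorem Nice.one_le_cdes {a : ℕ} {ts : List LTree} (h : Nice true (node a ts)) (hts : ts ≠ []) :
    1 ≤ (node a ts).cdes := by
  cases h with
  | even h1 h2 h3 =>
    rw [cdes_node]
    exact le_add_right (one_le_cdesW (by simpa using hts) (by simpa using h1))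

end LTree

/-! ### Enumeration of weakly increasing trees -/

theorem msetM_succ (n : ℕ) (k : ℕ → ℕ) :
    msetM (n + 1) k = msetM n k + Multiset.replicate (k (n + 1)) (n + 1) := by
  rw [msetM, Finset.sum_Icc_succ_top (by omega), msetM]

theorem card_msetM (n : ℕ) (k : ℕ → ℕ) : (msetM n k).card = ∑ i ∈ Finset.Icc 1 n, k i := by
  simp [msetM, Multiset.card_sum]

theorem le_of_mem_msetM {n : ℕ} {k : ℕ → ℕ} {x : ℕ} (h : x ∈ msetM n k) : x ≤ n := by
  obtain ⟨i, hi, hx⟩ := Multiset.mem_sum.1 h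
  rw [Multiset.eq_of_mem_replicate hx]
  exact (Finset.mem_Icc.1 hi).2

theorem memIT.le_of_mem_labels {n : ℕ} {k : ℕ → ℕ} {T : LTree} (h : memIT n k T) {x : ℕ}
    (hx : x ∈ T.labels) : x ≤ n := by
  rw [h.1.2.1, Multiset.mem_cons] at hx
  rcases hx with rfl | hx
  · exact Nat.zero_le n
  · exact le_of_mem_msetM hx

theorem memIT.children_ne_nil {n a : ℕ} {k : ℕ → ℕ} {ts : List LTree}
    (h : memIT n k (LTree.node a ts)) (hpos : 0 < ∑ i ∈ Finset.Icc 1 n, k i) : ts ≠ [] := by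
  rintro rfl
  have := congrArg Multiset.card h.1.2.1
  rw [LTree.card_labels_node, Multiset.card_cons, card_msetM] at this
  simp only [List.map_nil, List.sum_nil] at this
  omega

/-- The list of all weakly increasing trees, built by successively inserting the labels. -/
def incrTrees (k : ℕ → ℕ) : ℕ → List LTree
  | 0 => [LTree.node 0 []]
  | n + 1 => (incrTrees k n).flatMap fun T =>
      LTree.ins (LTree.bush (n + 1) (k (n + 1) - 1)) T true

theorem mem_incrTrees {k : ℕ → ℕ} {n : ℕ} (hk : ∀ i, 1 ≤ i → i ≤ n → 1 ≤ k i) {T : LTree} :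
    T ∈ incrTrees k n ↔ memIT n k T := by
  induction n generalizing T with
  | zero =>
    rw [incrTrees, List.mem_singleton]
    constructor
    · rintro rfl
      simp [memIT, memTM, LTree.label_node, LTree.labels_node, LTree.oddOK_node, LTree.incr_node,
        msetM]
    · intro h
      cases T with
      | node a ts =>
        obtain rfl : a = 0 := h.1.1
        have h1 := h.1.2.1
        cases ts with
        | nil => rfl
        | cons t ts =>
          have h2 := congrArg Multiset.card h1
          have h3 := Multiset.card_pos_iff_exists_mem.2 ⟨_, t.label_mem_labels⟩
          rw [LTree.card_labels_node] at h2
          simp [msetM] at h2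
          simp [h2] at h3
  | succ n ih =>
    have ih := fun {T} => ih (T := T) fun i h1 h2 => hk i h1 (by omega)
    have hkn := hk (n + 1) (by omega) le_rfl
    simp only [incrTrees, List.mem_flatMap, ih]
    have hlab : ∀ {T S : LTree}, T ∈ LTree.ins (LTree.bush (n + 1) (k (n + 1) - 1)) S true →
        T.labels = S.labels + Multiset.replicate (k (n + 1)) (n + 1) := fun h => by
      rw [LTree.labels_of_mem_ins h, LTree.labels_bush, Nat.sub_add_cancel hkn]
    constructor
    · rintro ⟨S, hS, hT⟩
      refine ⟨⟨?_, ?_, ?_⟩, ?_⟩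
      · rw [LTree.label_of_mem_ins hT, hS.1.1]
      · rw [hlab hT, hS.1.2.1, msetM_succ, Multiset.cons_add]
      · exact LTree.oddOK_of_mem_ins (LTree.oddOK_bush rfl) hT hS.1.2.2
      · refine LTree.incr_of_mem_ins (LTree.incr_bush _ _) hT (fun x hx => ?_) hS.2
        exact Nat.lt_succ_of_le (hS.le_of_mem_labels hx)
    · intro hT
      have hcount : (msetM n k).count (n + 1) = 0 :=
        Multiset.count_eq_zero.2 fun h => absurd (le_of_mem_msetM h) (by omega)
      obtain ⟨S, hS, ho, hi⟩ := LTree.exists_mem_ins (N := n + 1) hkn T hT.1.2.2 hT.2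
        (fun x hx => hT.le_of_mem_labels hx) (by rw [hT.1.1]; omega)
        (by rw [hT.1.2.1, Multiset.count_cons_of_ne (by omega), msetM_succ, Multiset.count_add,
          hcount, Multiset.count_replicate_self, zero_add])
      refine ⟨S, ⟨⟨?_, ?_, ho⟩, hi⟩, hS⟩
      · rw [← LTree.label_of_mem_ins hS, hT.1.1]
      · have h1 := hT.1.2.1
        rw [hlab hS, msetM_succ, ← Multiset.cons_add] at h1
        exact add_right_cancel h1

theorem nodup_incrTrees {k : ℕ → ℕ} {n : ℕ} (hk : ∀ i, 1 ≤ i → i ≤ n → 1 ≤ k i) :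
    (incrTrees k n).Nodup := by
  induction n with
  | zero => simp [incrTrees]
  | succ n ih =>
    have hk' : ∀ i, 1 ≤ i → i ≤ n → 1 ≤ k i := fun i h1 h2 => hk i h1 (by omega)
    have hfresh : ∀ T ∈ incrTrees k n, n + 1 ∉ T.labels := fun T hT hm => by
      have := ((mem_incrTrees hk').1 hT).le_of_mem_labels hm
      omega
    rw [incrTrees, List.nodup_flatMap]
    refine ⟨fun T hT => LTree.nodup_ins (hfresh T hT), (ih hk').imp_of_mem ?_⟩
    intro S T hS hT hne U hU hU'
    exact hne ((LTree.del_of_mem_ins rfl hU (hfresh S hS)).symm.trans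
      (LTree.del_of_mem_ins rfl hU' (hfresh T hT)))

theorem nice_of_mem_incrTrees {k : ℕ → ℕ} {n : ℕ} (hk : ∀ i, 1 ≤ i → i ≤ n → 1 ≤ k i)
    {T : LTree} (hT : T ∈ incrTrees k n) : LTree.Nice true T := by
  induction n generalizing T with
  | zero =>
    obtain rfl := List.mem_singleton.1 hT
    exact .even (by simp) (by simp) (by simp)
  | succ n ih =>
    have hk' : ∀ i, 1 ≤ i → i ≤ n → 1 ≤ k i := fun i h1 h2 => hk i h1 (by omega)
    obtain ⟨S, hS, hT⟩ := List.mem_flatMap.1 hT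
    exact LTree.nice_of_mem_ins (LTree.nice_bush _ _) hT
      (fun x hx => Nat.lt_succ_of_le (((mem_incrTrees hk').1 hS).le_of_mem_labels hx)) (ih hk' hS)

theorem eleaf_add_le {k : ℕ → ℕ} {n : ℕ} (hk : ∀ i, 1 ≤ i → i ≤ n + 1 → 1 ≤ k i)
    {T : LTree} (hT : T ∈ incrTrees k (n + 1)) :
    T.eleaf + (n + 1) ≤ ∑ i ∈ Finset.Icc 1 (n + 1), k i := by
  induction n generalizing T with
  | zero =>
    have := hk 1 le_rfl le_rfl
    obtain ⟨S, hS, hT⟩ := List.mem_flatMap.1 hT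
    obtain rfl := List.mem_singleton.1 hS
    rcases LTree.mem_ins_node.1 hT with ⟨_, l₁, l₂, e, rfl⟩ | ⟨l₁, s, l₂, s', e, _, _⟩
    · obtain ⟨rfl, rfl⟩ := List.append_eq_nil_iff.1 e.symm
      simp [LTree.eleaf, LTree.eleafAux_node, LTree.eleafAux_bush]
      omega
    · simp at e
  | succ n ih =>
    have := hk (n + 1 + 1) (by omega) le_rfl
    obtain ⟨S, hS, hT⟩ := List.mem_flatMap.1 hT
    have h1 := ih (fun i h1 h2 => hk i h1 (by omega)) hS
    have h2 := LTree.eleafAux_of_mem_ins hT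
    rw [LTree.eleafAux_bush] at h2
    rw [Finset.sum_Icc_succ_top (by omega)]
    simp only [LTree.eleaf] at h1 ⊢
    omega

/-! ### The generating function -/

/-- The subring of `ℤ[u, s, t, z]` generated by `u`, `s + t` and `z`. -/
noncomputable def gammaSubalgebra : Subalgebra ℤ WeightRing :=
  Algebra.adjoin ℤ {X 0, X 1 + X 2, X 3}

theorem X0_mem_gammaSubalgebra : (X 0 : WeightRing) ∈ gammaSubalgebra :=
  Algebra.subset_adjoin (by simp)

theorem X1_add_X2_mem_gammaSubalgebra : (X 1 + X 2 : WeightRing) ∈ gammaSubalgebra :=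
  Algebra.subset_adjoin (by simp)

theorem X3_mem_gammaSubalgebra : (X 3 : WeightRing) ∈ gammaSubalgebra :=
  Algebra.subset_adjoin (by simp)

theorem grammarD_mem_gammaSubalgebra {p : WeightRing} (hp : p ∈ gammaSubalgebra) :
    grammarD p ∈ gammaSubalgebra := by
  refine Algebra.adjoin_induction (p := fun p _ => grammarD p ∈ gammaSubalgebra) ?_ ?_ ?_ ?_ hp
  · intro x hx
    simp only [Set.mem_insert_iff, Set.mem_singleton_iff] at hx
    rcases hx with rfl | rfl | rfl
    · rw [grammarD_X0]
      exact mul_mem X0_mem_gammaSubalgebra X1_add_X2_mem_gammaSubalgebra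
    · rw [map_add, grammarD_X1, grammarD_X2]
      exact add_mem X0_mem_gammaSubalgebra X0_mem_gammaSubalgebra
    · rw [grammarD_X3]
      exact X0_mem_gammaSubalgebra
  · intro r
    rw [Derivation.map_algebraMap]
    exact zero_mem _
  · intro x y _ _ hx hy
    rw [map_add]
    exact add_mem hx hy
  · intro x y hx' hy' hx hy
    rw [Derivation.leibniz]
    exact add_mem (mul_mem hx' hy) (mul_mem hy' hx)

theorem sum_treeWt_mem_gammaSubalgebra {k : ℕ → ℕ} {n : ℕ}
    (hk : ∀ i, 1 ≤ i → i ≤ n → 1 ≤ k i) :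
    ((incrTrees k n).map (LTree.treeWt true)).sum ∈ gammaSubalgebra := by
  induction n with
  | zero =>
    have : LTree.treeWt true (LTree.node 0 []) = X 3 := by
      simp [LTree.treeWt_node_true, wordWt, cpeakW, dcascW, dcdesW, cycTriples]
    simpa [incrTrees, this] using X3_mem_gammaSubalgebra
  | succ n ih =>
    have hk' : ∀ i, 1 ≤ i → i ≤ n → 1 ≤ k i := fun i h1 h2 => hk i h1 (by omega)
    have key : ((incrTrees k (n + 1)).map (LTree.treeWt true)).sum
        = X 3 ^ (k (n + 1) - 1) *
            grammarD ((incrTrees k n).map (LTree.treeWt true)).sum := by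
      rw [incrTrees, List.map_flatMap, List.flatMap_def, List.sum_flatten, List.map_map,
        map_list_sum, ← List.sum_map_mul_left, List.map_map]
      refine congrArg List.sum (List.map_congr_left fun T hT => ?_)
      have hlt : ∀ x ∈ T.labels, x < (LTree.bush (n + 1) (k (n + 1) - 1)).label := fun x hx =>
        Nat.lt_succ_of_le (((mem_incrTrees hk').1 hT).le_of_mem_labels hx)
      rw [Function.comp_apply, LTree.sum_treeWt_ins (nice_of_mem_incrTrees hk' hT) hlt,
        LTree.treeWt_bush]
      rfl
    rw [key]
    exact mul_mem (pow_mem X3_mem_gammaSubalgebra _) (grammarD_mem_gammaSubalgebra (ih hk'))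

theorem aeval_eq_aeval_of_mem_gammaSubalgebra {R : Type*} [CommRing R] (x y z : R)
    {p : WeightRing} (hp : p ∈ gammaSubalgebra) :
    aeval ![x * y, x, y, z] p = aeval ![x * y, x + y, 0, z] p := by
  have : gammaSubalgebra ≤ AlgHom.equalizer (aeval ![x * y, x, y, z] : WeightRing →ₐ[ℤ] R)
      (aeval ![x * y, x + y, 0, z]) := by
    refine Algebra.adjoin_le ?_
    rintro q (rfl | rfl | rfl) <;> simp
  exact this hp

theorem sum_incrTrees_eq {R : Type*} [CommRing R] (x y z : R) {k : ℕ → ℕ} {n : ℕ}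
    (hk : ∀ i, 1 ≤ i → i ≤ n → 1 ≤ k i) :
    ((incrTrees k n).map fun T => x ^ T.casc * y ^ T.cdes * z ^ T.eleaf).sum
      = ((incrTrees k n).map fun T =>
          (x * y) ^ T.cpeak * (x + y) ^ T.dcasc * 0 ^ T.dcdes * z ^ T.eleaf).sum := by
  have h := aeval_eq_aeval_of_mem_gammaSubalgebra x y z (sum_treeWt_mem_gammaSubalgebra hk)
  rw [map_list_sum, map_list_sum, List.map_map, List.map_map] at h
  refine Eq.trans ?_ (h.trans ?_) <;>
    refine congrArg List.sum (List.map_congr_left fun T hT => ?_)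
  · have hT' := nice_of_mem_incrTrees hk hT
    simp only [hT'.casc_eq, hT'.cdes_eq, Function.comp_apply, LTree.treeWt, map_mul, map_pow,
      aeval_X, LTree.eleaf, pow_add]
    simp
    ring
  · simp [LTree.treeWt, LTree.cpeak, LTree.dcasc, LTree.dcdes, LTree.eleaf]

theorem memIT.bounds {n : ℕ} (hn : 1 ≤ n) {k : ℕ → ℕ} (hk : ∀ i, 1 ≤ i → i ≤ n → 1 ≤ k i)
    {T : LTree} (hT : memIT n k T) :
    T.casc + T.cdes + T.eleaf = (∑ i ∈ Finset.Icc 1 n, k i) + 1 ∧ 1 ≤ T.cdes ∧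
      T.eleaf + n ≤ ∑ i ∈ Finset.Icc 1 n, k i := by
  have hmem := (mem_incrTrees hk).2 hT
  have hnice := nice_of_mem_incrTrees hk hmem
  have hle : T.eleaf + n ≤ ∑ i ∈ Finset.Icc 1 n, k i := by
    obtain ⟨m, rfl⟩ : ∃ m, n = m + 1 := ⟨n - 1, by omega⟩
    exact eleaf_add_le hk hmem
  refine ⟨?_, ?_, hle⟩
  · have := hnice.casc_add_cdes_add_eleafAux
    rw [hT.1.2.1, Multiset.card_cons, card_msetM] at this
    simpa [LTree.eleaf] using this
  · cases T with
    | node a ts => exact hnice.one_le_cdes (hT.children_ne_nil (by omega))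

/-- A sum over a finite set, grouped by the values of two statistics. -/
theorem sum_eq_sum_card_mul {α R : Type*} [CommSemiring R] (S : Finset α) (f g : α → ℕ)
    (F : ℕ → ℕ → R) (I : Finset ℕ) (J : ℕ → Finset ℕ) (hf : ∀ T ∈ S, f T ∈ I)
    (hg : ∀ T ∈ S, g T ∈ J (f T)) :
    ∑ T ∈ S, F (f T) (g T)
      = ∑ i ∈ I, ∑ j ∈ J i, ((S.filter fun T => f T = i ∧ g T = j).card : R) * F i j := by
  rw [← Finset.sum_fiberwise_of_maps_to hf]
  refine Finset.sum_congr rfl fun i _ => ?_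
  have hg' : ∀ T ∈ S.filter fun T => f T = i, g T ∈ J i := fun T hT => by
    obtain ⟨h1, rfl⟩ := Finset.mem_filter.1 hT
    exact hg T h1
  rw [← Finset.sum_fiberwise_of_maps_to hg']
  refine Finset.sum_congr rfl fun j _ => ?_
  rw [Finset.filter_filter, Finset.sum_congr rfl (g := fun _ => F i j), Finset.sum_const,
    nsmul_eq_mul]
  intro T hT
  obtain ⟨_, rfl, rfl⟩ := Finset.mem_filter.1 hT
  rfl

end

open MvPolynomial in
/-- **Theorem 2.3 (Yan–Huang–Yang).**  For `M = {1^{k 1}, …, n^{k n}}` with every `k i ≥ 1`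
and `K = k 1 + ⋯ + k n`, the polynomial
`IT_M(x,y,z) = ∑_{T ∈ ℐ𝒯_M} x^{casc T} y^{cdes T} z^{eleaf T}` is partial γ-positive, with
`IT_M(x,y,z) = ∑_{i=0}^{K-n} z^i ∑_{j=1}^{⌊(K+1-i)/2⌋} γ_{i,j} (xy)^j (x+y)^{K+1-i-2j}`,
where `γ_{i,j} = #{T ∈ ℐ𝒯_M : cdes T = j, eleaf T = i, dcdes T = 0}`.
Here `x = X 0`, `y = X 1`, `z = X 2` in `ℤ[x,y,z] = MvPolynomial (Fin 3) ℤ`. -/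
theorem increasing_tree_poly_partial_gamma_positive
    (n : ℕ) (hn : 1 ≤ n) (k : ℕ → ℕ) (hk : ∀ i, 1 ≤ i → i ≤ n → 1 ≤ k i)
    (K : ℕ) (hK : K = ∑ i ∈ Finset.Icc 1 n, k i) :
    (∑ᶠ T ∈ {T : LTree | memIT n k T},
        (X 0 : MvPolynomial (Fin 3) ℤ) ^ T.casc * X 1 ^ T.cdes * X 2 ^ T.eleaf)
      = ∑ i ∈ Finset.range (K - n + 1), (X 2 : MvPolynomial (Fin 3) ℤ) ^ i *
          ∑ j ∈ Finset.Icc 1 ((K + 1 - i) / 2),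
            ({T : LTree | memIT n k T ∧ T.cdes = j ∧ T.eleaf = i ∧ T.dcdes = 0}.ncard :
                MvPolynomial (Fin 3) ℤ)
              * (X 0 * X 1) ^ j * (X 0 + X 1) ^ (K + 1 - i - 2 * j) := by
  classical
  set S : Finset LTree := (incrTrees k n).toFinset with hS
  have hmem : ∀ T, T ∈ S ↔ memIT n k T := fun T => by rw [hS, List.mem_toFinset, mem_incrTrees hk]
  have hset : {T : LTree | memIT n k T} = (S : Set LTree) := by
    ext T
    simp [hmem]
  rw [hset, finsum_mem_coe_finset, hS, List.sum_toFinset _ (nodup_incrTrees hk),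
    sum_incrTrees_eq _ _ _ hk, ← List.sum_toFinset _ (nodup_incrTrees hk), ← hS]
  have hstat : ∀ T ∈ S, T.casc = T.cpeak + T.dcasc ∧ T.cdes = T.cpeak + T.dcdes ∧
      T.casc + T.cdes + T.eleaf = K + 1 ∧ 1 ≤ T.cdes ∧ T.eleaf + n ≤ K := fun T hT => by
    have hnice := nice_of_mem_incrTrees hk (List.mem_toFinset.1 hT)
    obtain ⟨h1, h2, h3⟩ := ((hmem T).1 hT).bounds hn hk
    exact ⟨hnice.casc_eq, hnice.cdes_eq, hK ▸ h1, h2, hK ▸ h3⟩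
  have hfilter : ∑ T ∈ S, (X 0 * X 1 : MvPolynomial (Fin 3) ℤ) ^ T.cpeak * (X 0 + X 1) ^ T.dcasc
        * 0 ^ T.dcdes * X 2 ^ T.eleaf
      = ∑ T ∈ S.filter fun T => T.dcdes = 0, (X 2 : MvPolynomial (Fin 3) ℤ) ^ T.eleaf *
          ((X 0 * X 1) ^ T.cdes * (X 0 + X 1) ^ (K + 1 - T.eleaf - 2 * T.cdes)) := by
    rw [Finset.sum_filter]
    refine Finset.sum_congr rfl fun T hT => ?_
    obtain ⟨h1, h2, h3, -, -⟩ := hstat T hT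
    split_ifs with h0
    · rw [show K + 1 - T.eleaf - 2 * T.cdes = T.dcasc by omega, show T.cdes = T.cpeak by omega, h0]
      ring
    · simp [h0]
  rw [hfilter, sum_eq_sum_card_mul _ LTree.eleaf LTree.cdes
    (fun i j => (X 2 : MvPolynomial (Fin 3) ℤ) ^ i *
      ((X 0 * X 1) ^ j * (X 0 + X 1) ^ (K + 1 - i - 2 * j)))
    (Finset.range (K - n + 1)) fun i => Finset.Icc 1 ((K + 1 - i) / 2)]
  · refine Finset.sum_congr rfl fun i _ => ?_
    rw [Finset.mul_sum]
    refine Finset.sum_congr rfl fun j _ => ?_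
    have hcard : {T : LTree | memIT n k T ∧ T.cdes = j ∧ T.eleaf = i ∧ T.dcdes = 0}
        = ((S.filter fun T => T.dcdes = 0).filter fun T => T.eleaf = i ∧ T.cdes = j :
            Finset LTree) := by
      ext T
      simp only [Set.mem_ofPred_eq, Finset.coe_filter, Finset.mem_filter, hmem]
      tauto
    rw [hcard, Set.ncard_coe_finset]
    ring
  · intro T hT
    obtain ⟨-, -, -, -, h⟩ := hstat T (Finset.mem_filter.1 hT).1
    rw [Finset.mem_range]
    omega
  · intro T hT
    obtain ⟨hT, h0⟩ := Finset.mem_filter.1 hT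
    obtain ⟨h1, h2, h3, h4, -⟩ := hstat T hT
    rw [Finset.mem_Icc]
    omega
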